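/- arXiv:1205.5049 — 5 statements merged into one kernel-verified Lean document; each statement's English description precedes it below -/
import Mathlib

section
/- Let l be a real number with -1/2 < l < 1/2. Set ν = l + 1/2, α = (1-2l)/(1+2l), K_ν = ν^{1-ν} Γ(ν) / ((1-ν)^ν Γ(1-ν)), A_α = (1-2l)(1+2l)^{(2l+3)/(2l+1)}, and C_l = √π / (Γ(l+3/2) 2^{l+1}), where Γ denotes the real Gamma function. Then K_ν · A_α^ν = 2^{2l} (2l+1)^2 Γ(1/2+l)/Γ(1/2-l) = sin(π(l+1/2)) / C_l^2. -/
open Real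

theorem stmt_0 (l ν α Kν Aα Cl : ℝ)
    (hl1 : -(1/2) < l) (hl2 : l < 1/2)
    (hν : ν = l + 1/2)
    (hα : α = (1 - 2*l) / (1 + 2*l))
    (hK : Kν = ν ^ (1 - ν) * Real.Gamma ν / ((1 - ν) ^ ν * Real.Gamma (1 - ν)))
    (hA : Aα = (1 - 2*l) * (1 + 2*l) ^ ((2*l + 3) / (2*l + 1)))
    (hC : Cl = Real.sqrt π / (Real.Gamma (l + 3/2) * 2 ^ (l + 1))) :
    Kν * Aα ^ ν = 2 ^ (2*l) * (2*l + 1) ^ 2 * Real.Gamma (1/2 + l) / Real.Gamma (1/2 - l)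
    ∧ Kν * Aα ^ ν = Real.sin (π * (l + 1/2)) / Cl ^ 2 := by
  obtain rfl : l = ν - 1/2 := by linarith
  have h0 : 0 < ν := by linarith
  have h1 : 0 < 1 - ν := by linarith
  have hΓ := Real.Gamma_pos_of_pos h0
  have hΓ' := Real.Gamma_pos_of_pos h1
  have hA_pow : Aα ^ ν = 2 ^ ν * (1 - ν) ^ ν * (2 ^ (ν + 1) * ν ^ (ν + 1)) := by
    have e1 : 1 - 2 * (ν - 1/2) = 2 * (1 - ν) := by ring
    have e2 : 1 + 2 * (ν - 1/2) = 2 * ν := by ring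
    have e3 : (2 * (ν - 1/2) + 3) / (2 * (ν - 1/2) + 1) * ν = ν + 1 := by
      rw [show 2 * (ν - 1/2) + 1 = 2 * ν by ring]
      field_simp
      ring
    rw [hA, e1, e2, Real.mul_rpow (by positivity) (by positivity),
      ← Real.rpow_mul (by positivity), e3, Real.mul_rpow (by norm_num) h1.le,
      Real.mul_rpow (by norm_num) h0.le]
  have hν_pow : ν ^ (1 - ν) * ν ^ (ν + 1) = ν ^ 2 := by
    rw [← Real.rpow_add h0, show 1 - ν + (ν + 1) = ((2 : ℕ) : ℝ) by push_cast; ring,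
      Real.rpow_natCast]
  have htwo_succ : (2 : ℝ) ^ (ν + 1) = 2 ^ ν * 2 := by
    rw [Real.rpow_add (by norm_num), Real.rpow_one]
  have hmain : Kν * Aα ^ ν = 2 * (2 ^ ν) ^ 2 * ν ^ 2 * Real.Gamma ν / Real.Gamma (1 - ν) := by
    have hp : (1 - ν) ^ ν ≠ 0 := (Real.rpow_pos_of_pos h1 ν).ne'
    rw [hK, hA_pow, htwo_succ, ← hν_pow]
    field_simp
  refine ⟨?_, ?_⟩
  · have htwo : (2 : ℝ) ^ (2 * (ν - 1/2)) * 2 = (2 ^ ν) ^ 2 := by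
      rw [← Real.rpow_add_one (by norm_num), ← Real.rpow_mul_natCast (by norm_num)]
      congr 1
      push_cast
      ring
    rw [hmain, ← htwo, show 1/2 + (ν - 1/2) = ν by ring, show 1/2 - (ν - 1/2) = 1 - ν by ring]
    ring
  · have hsin : Real.sin (π * ν) = π / (Real.Gamma ν * Real.Gamma (1 - ν)) := by
      rw [Real.Gamma_mul_Gamma_one_sub, div_div_cancel₀ Real.pi_ne_zero]
    have htwo : ((2 : ℝ) ^ (ν - 1/2 + 1)) ^ 2 = 2 * (2 ^ ν) ^ 2 := by
      rw [← Real.rpow_mul_natCast (by norm_num), ← Real.rpow_mul_natCast (by norm_num),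
        mul_comm 2, ← Real.rpow_add_one (by norm_num)]
      congr 1
      push_cast
      ring
    rw [hmain, hC, show ν - 1/2 + 1/2 = ν by ring, show ν - 1/2 + 3/2 = ν + 1 by ring,
      Real.Gamma_add_one h0.ne', div_pow, Real.sq_sqrt Real.pi_pos.le, mul_pow, htwo, hsin]
    have := Real.pi_ne_zero
    field_simp
end

section
/- Let h : (0,1] → (0,∞) be continuous with h(t) → 1 as t → 0⁺. Then (1/x) ∫₀^{e^{-1/x}} dt/(t (log t)² h(t)²) → 1 as x → 0⁺. -/
open Filter Set MeasureTheory

lemma continuousOn_neg_inv_log {b : ℝ} (hb : b < 1) :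
    ContinuousOn (fun t : ℝ => -(Real.log t)⁻¹) (Icc 0 b) := by
  intro t ht
  apply ContinuousAt.continuousWithinAt
  rcases ht.1.eq_or_lt with rfl | h0
  · rw [continuousAt_iff_punctured_nhds]
    simpa using (tendsto_inv_atBot_zero.comp Real.tendsto_log_nhdsNE_zero).neg
  · have hlog : Real.log t ≠ 0 := (Real.log_neg h0 (ht.2.trans_lt hb)).ne
    exact ((Real.continuousAt_log h0.ne').inv₀ hlog).neg

lemma hasDerivAt_neg_inv_log {t : ℝ} (h0 : 0 < t) (h1 : t < 1) :
    HasDerivAt (fun t : ℝ => -(Real.log t)⁻¹) (1 / (t * Real.log t ^ 2)) t := by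
  have hlog : Real.log t ≠ 0 := (Real.log_neg h0 h1).ne
  refine ((Real.hasDerivAt_log h0.ne').inv hlog).neg.congr_deriv ?_
  rw [neg_div, neg_neg, one_div, mul_inv, div_eq_mul_inv]

lemma integrableOn_one_div_mul_log_sq {b : ℝ} (hb : b < 1) :
    IntegrableOn (fun t : ℝ => 1 / (t * Real.log t ^ 2)) (Ioc 0 b) :=
  intervalIntegral.integrableOn_deriv_of_nonneg (continuousOn_neg_inv_log hb)
    (fun t ht => hasDerivAt_neg_inv_log ht.1 (ht.2.trans hb))
    (fun t ht => by have := ht.1; positivity)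

lemma setIntegral_one_div_mul_log_sq {b : ℝ} (h0 : 0 < b) (hb : b < 1) :
    ∫ t in Ioo 0 b, 1 / (t * Real.log t ^ 2) = -(Real.log b)⁻¹ := by
  rw [← integral_Ioc_eq_integral_Ioo, ← intervalIntegral.integral_of_le h0.le,
    intervalIntegral.integral_eq_sub_of_hasDerivAt_of_le h0.le (continuousOn_neg_inv_log hb)
      (fun t ht => hasDerivAt_neg_inv_log ht.1 (ht.2.trans hb))
      ((intervalIntegrable_iff_integrableOn_Ioc_of_le h0.le).2
        (integrableOn_one_div_mul_log_sq hb))]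
  simp

/-- If a weight `w` is integrable and nonnegative and `k` is within `ε` of `1`, then replacing `w`
by `w * k` changes the integral by at most `ε` times the integral of `w`. -/
lemma abs_setIntegral_mul_sub_le {w k : ℝ → ℝ} {s : Set ℝ} {ε : ℝ} (hs : MeasurableSet s)
    (hw : IntegrableOn w s) (hw0 : ∀ t ∈ s, 0 ≤ w t)
    (hk : AEStronglyMeasurable k (volume.restrict s)) (hkε : ∀ t ∈ s, |k t - 1| ≤ ε) :
    |(∫ t in s, w t * k t) - ∫ t in s, w t| ≤ ε * ∫ t in s, w t := by
  have hb : ∀ᵐ t ∂volume.restrict s, ‖w t * (k t - 1)‖ ≤ ε * w t := by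
    filter_upwards [ae_restrict_mem hs] with t ht
    rw [Real.norm_eq_abs, abs_mul, abs_of_nonneg (hw0 t ht), mul_comm]
    exact mul_le_mul_of_nonneg_right (hkε t ht) (hw0 t ht)
  have hd : Integrable (fun t => w t * (k t - 1)) (volume.restrict s) :=
    (hw.const_mul ε).mono' (hw.aestronglyMeasurable.mul (hk.sub aestronglyMeasurable_const)) hb
  have hwk : Integrable (fun t => w t * k t) (volume.restrict s) :=
    (hd.add hw).congr (.of_forall fun t => by simp only [Pi.add_apply]; ring)
  rw [← integral_sub hwk hw, ← integral_const_mul]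
  refine (norm_integral_le_of_norm_le (hw.const_mul ε) hb).trans' (le_of_eq ?_)
  rw [Real.norm_eq_abs]
  simp only [mul_sub, mul_one]

lemma tendsto_exp_neg_one_div :
    Tendsto (fun x : ℝ => Real.exp (-1 / x)) (nhdsWithin 0 (Ioi 0)) (nhds 0) := by
  refine Real.tendsto_exp_atBot.comp ?_
  refine (tendsto_neg_atTop_atBot.comp (tendsto_inv_nhdsGT_zero (𝕜 := ℝ))).congr fun x => ?_
  rw [Function.comp_apply, neg_div, one_div]

theorem stmt_8 (h : ℝ → ℝ)
    (hc : ContinuousOn h (Ioc 0 1))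
    (hpos : ∀ t ∈ Ioc (0:ℝ) 1, 0 < h t)
    (hlim : Tendsto h (nhdsWithin 0 (Ioi 0)) (nhds 1)) :
    Tendsto (fun x : ℝ =>
        (1/x) * ∫ t in Ioo (0:ℝ) (Real.exp (-1/x)), 1 / (t * (Real.log t) ^ 2 * (h t) ^ 2))
      (nhdsWithin 0 (Ioi 0)) (nhds 1) := by
  have hklim : Tendsto (fun t => (h t ^ 2)⁻¹) (nhdsWithin 0 (Ioi 0)) (nhds 1) := by
    simpa using (hlim.pow 2).inv₀ (by norm_num)
  rw [Metric.tendsto_nhds]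
  intro ε hε
  obtain ⟨η, hη, hηk⟩ := mem_nhdsGT_iff_exists_Ioo_subset.1
    (hklim (Metric.closedBall_mem_nhds 1 (half_pos hε)))
  filter_upwards [self_mem_nhdsWithin,
    tendsto_exp_neg_one_div.eventually (gt_mem_nhds (mem_Ioi.1 hη))] with x hx hxη
  replace hx : 0 < x := hx
  have hb1 : Real.exp (-1 / x) < 1 :=
    Real.exp_lt_one_iff.2 (div_neg_of_neg_of_pos (by norm_num) hx)
  have hsub : Ioo 0 (Real.exp (-1 / x)) ⊆ Ioc 0 1 := fun t ht => ⟨ht.1, (ht.2.trans hb1).le⟩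
  have hint : ∫ t in Ioo 0 (Real.exp (-1 / x)), 1 / (t * Real.log t ^ 2) = x := by
    rw [setIntegral_one_div_mul_log_sq (Real.exp_pos _) hb1, Real.log_exp, inv_div]
    ring
  have hk : AEStronglyMeasurable (fun t => (h t ^ 2)⁻¹)
      (volume.restrict (Ioo 0 (Real.exp (-1 / x)))) :=
    (((hc.mono hsub).pow 2).inv₀ fun t ht =>
      (pow_pos (hpos t (hsub ht)) 2).ne').aestronglyMeasurable measurableSet_Ioo
  have key := abs_setIntegral_mul_sub_le (ε := ε / 2) measurableSet_Ioo
    ((integrableOn_one_div_mul_log_sq hb1).mono_set Ioo_subset_Ioc_self)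
    (fun t ht => by have := ht.1; positivity) hk
    (fun t ht => by simpa [Real.dist_eq] using hηk ⟨ht.1, ht.2.trans hxη⟩)
  have hfun : ∀ t, 1 / (t * Real.log t ^ 2 * h t ^ 2) =
      1 / (t * Real.log t ^ 2) * (h t ^ 2)⁻¹ := fun t => by
    rw [← div_div, div_eq_mul_inv (1 / _)]
  simp only [hfun]
  rw [hint] at key
  rw [Real.dist_eq]
  set I := ∫ t in Ioo 0 (Real.exp (-1 / x)), 1 / (t * Real.log t ^ 2) * (h t ^ 2)⁻¹
  have hI : 1 / x * I - 1 = (I - x) / x := by field_simp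
  rw [hI, abs_div, abs_of_pos hx, div_lt_iff₀ hx]
  nlinarith
end

section
/- Let f̃₀ : (4e, ∞) → (0,2) denote the inverse of the bijection ξ ↦ 2ξ e^{2/ξ} from (0,2) onto (4e,∞). Then f̃₀(y) · log(y) / 2 → 1 as y → +∞; that is, f̃₀(y) = (2/log y)(1 + o(1)). -/
open Filter Set

theorem stmt_12 (f : ℝ → ℝ)
    (hf : Set.InvOn f (fun ξ : ℝ => 2 * ξ * Real.exp (2/ξ))
      (Ioo 0 2) (Ioi (4 * Real.exp 1)))
    (hfmaps : Set.MapsTo f (Ioi (4 * Real.exp 1)) (Ioo 0 2)) :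
    Tendsto (fun y : ℝ => f y * Real.log y / 2) atTop (nhds 1) := by
  have hlog : ∀ y ∈ Ioi (4 * Real.exp 1), Real.log y = Real.log (2 * f y) + 2 / f y := by
    intro y hy
    have hpos : 0 < 2 * f y := by linarith [(hfmaps hy).1]
    have hinv : 2 * f y * Real.exp (2 / f y) = y := hf.2 hy
    calc Real.log y = Real.log (2 * f y * Real.exp (2 / f y)) := by rw [hinv]
      _ = Real.log (2 * f y) + 2 / f y := by
        rw [Real.log_mul hpos.ne' (Real.exp_pos _).ne', Real.log_exp]
  have hlarge : ∀ᶠ y : ℝ in atTop, y ∈ Ioi (4 * Real.exp 1) := Ioi_mem_atTop _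
  have hbound : Tendsto (fun y : ℝ => 2 / (Real.log y - Real.log 4)) atTop (nhds 0) :=
    (tendsto_atTop_add_const_right _ (-Real.log 4) Real.tendsto_log_atTop).const_div_atTop 2
  have hzero : Tendsto f atTop (nhds 0) := by
    refine squeeze_zero' ?_ ?_ hbound
    · filter_upwards [hlarge] with y hy using (hfmaps hy).1.le
    · filter_upwards [hlarge, Real.tendsto_log_atTop.eventually_gt_atTop (Real.log 4)]
        with y hy hy4
      obtain ⟨h0, h2⟩ := hfmaps hy
      have hle : Real.log (2 * f y) ≤ Real.log 4 :=
        Real.log_le_log (by linarith) (by linarith)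
      rw [le_div_comm₀ h0 (sub_pos.mpr hy4)]
      linarith [hlog y hy]
  have hmul : Tendsto (fun y => 2 * f y * Real.log (2 * f y) / 4 + 1) atTop (nhds 1) := by
    have h := (Real.continuous_mul_log.tendsto 0).comp
      (by simpa using hzero.const_mul 2 : Tendsto (fun y => 2 * f y) atTop (nhds 0))
    simpa using (h.div_const 4).add_const 1
  refine hmul.congr' ?_
  filter_upwards [hlarge] with y hy
  have h0 := (hfmaps hy).1.ne'
  rw [hlog y hy]
  field_simp
  ring
end

section
/- Let b > 0, α ∈ (0,∞), and let R, R₀ : (0,b) → (0,∞) be continuous strictly increasing functions such that R(x)/R₀(x) → 1 as x → 0⁺ and R₀(sx)/R₀(x) → s^α as x → 0⁺ for every s > 1. Define F(x) = 1/(x R(x)) and F₀(x) = 1/(x R₀(x)). Suppose f and f₀ are functions defined on a ray (y₁, ∞) with values in (0,b), satisfying F(f(y)) = y and F₀(f₀(y)) = y for all y > y₁, and f(y) → 0, f₀(y) → 0 as y → ∞. Then f(y)/f₀(y) → 1 as y → +∞. -/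
open Filter Set

/-- If `g` is monotone and positive at `a`, then `c / a` is at least as close to `1` as the ratio
`(c * g c) / (a * g a)`. -/
theorem abs_div_sub_one_le_of_monotoneOn {S : Set ℝ} {g : ℝ → ℝ} (hg : MonotoneOn g S)
    {a c r : ℝ} (ha : a ∈ S) (hc : c ∈ S) (ha0 : 0 < a) (hc0 : 0 < c)
    (hga : 0 < g a) (hr : r = (c / a) * (g c / g a)) : |c / a - 1| ≤ |r - 1| := by
  rcases le_total a c with h | h
  · have h1 : 1 ≤ c / a := (one_le_div ha0).2 h
    have h2 : 1 ≤ g c / g a := (one_le_div hga).2 (hg ha hc h)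
    have h3 : c / a ≤ r := by rw [hr]; exact le_mul_of_one_le_right (by linarith) h2
    rw [abs_of_nonneg (by linarith), abs_of_nonneg (by linarith)]
    linarith
  · have h1 : c / a ≤ 1 := (div_le_one ha0).2 h
    have h2 : g c / g a ≤ 1 := (div_le_one hga).2 (hg hc ha h)
    have h3 : r ≤ c / a := by
      rw [hr]; exact mul_le_of_le_one_right (div_pos hc0 ha0).le h2
    rw [abs_of_nonpos (by linarith), abs_of_nonpos (by linarith)]
    linarith

theorem stmt_13 (b α y₁ : ℝ) (hb : 0 < b) (hα : 0 < α)
    (R R₀ f f₀ : ℝ → ℝ)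
    (hRc : ContinuousOn R (Ioo 0 b)) (hRm : StrictMonoOn R (Ioo 0 b))
    (hRpos : ∀ x ∈ Ioo (0:ℝ) b, 0 < R x)
    (hR₀c : ContinuousOn R₀ (Ioo 0 b)) (hR₀m : StrictMonoOn R₀ (Ioo 0 b))
    (hR₀pos : ∀ x ∈ Ioo (0:ℝ) b, 0 < R₀ x)
    (hratio : Tendsto (fun x => R x / R₀ x) (nhdsWithin 0 (Ioi 0)) (nhds 1))
    (horder : ∀ s : ℝ, 1 < s →
      Tendsto (fun x => R₀ (s * x) / R₀ x) (nhdsWithin 0 (Ioi 0)) (nhds (s ^ α)))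
    (hf : ∀ y : ℝ, y₁ < y → f y ∈ Ioo (0:ℝ) b ∧ 1 / (f y * R (f y)) = y)
    (hf₀ : ∀ y : ℝ, y₁ < y → f₀ y ∈ Ioo (0:ℝ) b ∧ 1 / (f₀ y * R₀ (f₀ y)) = y)
    (hf0 : Tendsto f atTop (nhds 0)) (hf₀0 : Tendsto f₀ atTop (nhds 0)) :
    Tendsto (fun y => f y / f₀ y) atTop (nhds 1) := by
  have hfw : Tendsto f atTop (nhdsWithin 0 (Ioi 0)) :=
    tendsto_nhdsWithin_iff.2 ⟨hf0, (eventually_gt_atTop y₁).mono fun y hy => (hf y hy).1.1⟩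
  have hr : Tendsto (fun y => |R (f y) / R₀ (f y) - 1|) atTop (nhds 0) := by
    simpa using ((hratio.comp hfw).sub_const 1).abs
  have hinv : Tendsto (fun y => f₀ y / f y) atTop (nhds 1) := by
    rw [tendsto_iff_norm_sub_tendsto_zero]
    refine squeeze_zero' (Eventually.of_forall fun y => norm_nonneg _) ?_ hr
    filter_upwards [eventually_gt_atTop y₁] with y hy
    obtain ⟨hfm, hfy⟩ := hf y hy
    obtain ⟨hfm₀, hfy₀⟩ := hf₀ y hy
    have hprod : f y * R (f y) = f₀ y * R₀ (f₀ y) := by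
      rw [one_div] at hfy hfy₀
      exact inv_injective (hfy.trans hfy₀.symm)
    have hpos := hR₀pos _ hfm
    have hfpos := hfm.1
    refine abs_div_sub_one_le_of_monotoneOn hR₀m.monotoneOn hfm hfm₀ hfm.1 hfm₀.1 hpos ?_
    rw [div_mul_div_comm, ← hprod, mul_div_mul_left _ _ hfpos.ne']
  simpa using hinv.inv₀ one_ne_zero
end

section
/- Let b > 0 and let R, R₀ : (0,b) → (0,∞) be continuous strictly increasing functions such that R(x)/R₀(x) → 1 as x → 0⁺ and, for every s > 1, R₀(sx)/R₀(x) → +∞ as x → 0⁺ (i.e., R₀ has limit order ∞ at 0). Define F(x) = 1/(x R(x)) and F₀(x) = 1/(x R₀(x)). Suppose f and f₀ are functions defined on a ray (y₁, ∞) with values in (0,b), satisfying F(f(y)) = y and F₀(f₀(y)) = y for all y > y₁, and f(y) → 0, f₀(y) → 0 as y → ∞. Then f(y)/f₀(y) → 1 as y → +∞. -/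
open Filter Set

theorem stmt_14 (b y₁ : ℝ) (hb : 0 < b)
    (R R₀ f f₀ : ℝ → ℝ)
    (hRc : ContinuousOn R (Ioo 0 b)) (hRm : StrictMonoOn R (Ioo 0 b))
    (hRpos : ∀ x ∈ Ioo (0:ℝ) b, 0 < R x)
    (hR₀c : ContinuousOn R₀ (Ioo 0 b)) (hR₀m : StrictMonoOn R₀ (Ioo 0 b))
    (hR₀pos : ∀ x ∈ Ioo (0:ℝ) b, 0 < R₀ x)
    (hratio : Tendsto (fun x => R x / R₀ x) (nhdsWithin 0 (Ioi 0)) (nhds 1))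
    (horder : ∀ s : ℝ, 1 < s →
      Tendsto (fun x => R₀ (s * x) / R₀ x) (nhdsWithin 0 (Ioi 0)) atTop)
    (hf : ∀ y : ℝ, y₁ < y → f y ∈ Ioo (0:ℝ) b ∧ 1 / (f y * R (f y)) = y)
    (hf₀ : ∀ y : ℝ, y₁ < y → f₀ y ∈ Ioo (0:ℝ) b ∧ 1 / (f₀ y * R₀ (f₀ y)) = y)
    (hf0 : Tendsto f atTop (nhds 0)) (hf₀0 : Tendsto f₀ atTop (nhds 0)) :
    Tendsto (fun y => f y / f₀ y) atTop (nhds 1) := by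
  have hfw : Tendsto f atTop (nhdsWithin 0 (Ioi 0)) := by
    refine tendsto_nhdsWithin_iff.2 ⟨hf0, ?_⟩
    filter_upwards [eventually_gt_atTop y₁] with y hy using (hf y hy).1.1
  have hf₀w : Tendsto f₀ atTop (nhdsWithin 0 (Ioi 0)) := by
    refine tendsto_nhdsWithin_iff.2 ⟨hf₀0, ?_⟩
    filter_upwards [eventually_gt_atTop y₁] with y hy using (hf₀ y hy).1.1
  have heq : ∀ y, y₁ < y → f y * R (f y) = f₀ y * R₀ (f₀ y) := fun y hy =>
    inv_injective (by simpa only [one_div] using (hf y hy).2.trans (hf₀ y hy).2.symm)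
  have hupper : ∀ s : ℝ, 1 < s → ∀ᶠ y in atTop, f y < s * f₀ y := by
    intro s hs
    filter_upwards [eventually_gt_atTop y₁,
      (hratio.comp hfw).eventually (lt_mem_nhds (show (1 / 2 : ℝ) < 1 by norm_num)),
      ((horder s hs).comp hf₀w).eventually (eventually_gt_atTop 3)] with y hy hr ho
    obtain ⟨hu, -⟩ := hf y hy
    obtain ⟨hv, -⟩ := hf₀ y hy
    have he := heq y hy
    by_contra! hle
    have hsv : s * f₀ y ∈ Ioo 0 b := ⟨mul_pos (by linarith) hv.1, hle.trans_lt hu.2⟩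
    have hm := hR₀m.monotoneOn hsv hu hle
    have hr' := (lt_div_iff₀ (hR₀pos _ hu)).1 hr
    have ho' := (lt_div_iff₀ (hR₀pos _ hv)).1 ho
    have hvu : f₀ y < f y := by nlinarith [hv.1]
    have hRR : R₀ (f₀ y) < R (f y) := by linarith [hR₀pos _ hv]
    exact (mul_lt_mul'' hvu hRR hv.1.le (hR₀pos _ hv).le).ne' he
  have hlower : ∀ s : ℝ, 1 < s → ∀ᶠ y in atTop, f₀ y < s * f y := by
    intro s hs
    filter_upwards [eventually_gt_atTop y₁,
      (hratio.comp hfw).eventually (gt_mem_nhds (show (1 : ℝ) < 2 by norm_num)),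
      ((horder s hs).comp hfw).eventually (eventually_gt_atTop 3)] with y hy hr ho
    obtain ⟨hu, -⟩ := hf y hy
    obtain ⟨hv, -⟩ := hf₀ y hy
    have he := heq y hy
    by_contra! hle
    have hsu : s * f y ∈ Ioo 0 b := ⟨mul_pos (by linarith) hu.1, hle.trans_lt hv.2⟩
    have hm := hR₀m.monotoneOn hsu hv hle
    have hr' := (div_lt_iff₀ (hR₀pos _ hu)).1 hr
    have ho' := (lt_div_iff₀ (hR₀pos _ hu)).1 ho
    have huv : f y < f₀ y := by nlinarith [hu.1]
    have hRR : R (f y) < R₀ (f₀ y) := by linarith [hR₀pos _ hu]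
    exact (mul_lt_mul'' huv hRR hu.1.le (hRpos _ hu).le).ne he
  refine tendsto_order.2 ⟨fun a ha => ?_, fun a ha => ?_⟩
  · rcases le_or_gt a 0 with ha0 | ha0
    · filter_upwards [eventually_gt_atTop y₁] with y hy
      exact ha0.trans_lt (div_pos (hf y hy).1.1 (hf₀ y hy).1.1)
    · filter_upwards [eventually_gt_atTop y₁, hlower a⁻¹ ((one_lt_inv₀ ha0).2 ha)] with y hy h
      exact (lt_div_iff₀ (hf₀ y hy).1.1).2 ((lt_inv_mul_iff₀ ha0).1 h)
  · filter_upwards [eventually_gt_atTop y₁, hupper a ha] with y hy h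
    exact (div_lt_iff₀ (hf₀ y hy).1.1).2 h
end
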